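/- arXiv:1401.5702 — 5 statements merged into one kernel-verified Lean document; each statement's English description precedes it below -/
import Mathlib

section
/- Let 𝕜 be a normed field which is a proper metric space (closed balls in 𝕜 are compact), let n ≥ 0, and let c : Fin n → 𝕜 satisfy ‖c i‖ < 1 for every i. Consider the space ℓ¹ = lp (fun _ : (Fin n → ℕ) => 𝕜) 1 of families a = (a_k), indexed by multi-indices k ∈ ℕⁿ, with ∑_k ‖a_k‖ < ∞. Then there exists a continuous 𝕜-linear map T : ℓ¹ → ℓ¹ such that (T a)_k = (∏_i (c i)^(k i)) · a_k for every a ∈ ℓ¹ and every multi-index k, and T is a compact operator. -/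
open scoped ENNReal

instance : Fact (1 ≤ (1 : ℝ≥0∞)) := ⟨le_rfl⟩

theorem summable_prod_pow_aux (n : ℕ) (r : Fin n → ℝ) (h0 : ∀ i, 0 ≤ r i) (h1 : ∀ i, r i < 1) :
    Summable (fun k : Fin n → ℕ => ∏ i, r i ^ k i) := by
  induction n with
  | zero => exact Summable.of_finite
  | succ n ih =>
    have h := Summable.mul_of_nonneg (summable_geometric_of_lt_one (h0 0) (h1 0))
      (ih (fun i => r i.succ) (fun i => h0 _) (fun i => h1 _))
      (fun k => pow_nonneg (h0 0) k)
      (fun k => Finset.prod_nonneg fun i _ => pow_nonneg (h0 _) _)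
    rw [← (Fin.consEquiv (fun _ : Fin (n+1) => ℕ)).summable_iff]
    refine h.congr fun x => ?_
    simp [Fin.prod_univ_succ, Fin.consEquiv]

/-- The diagonal operator on `ℓ¹(ℕⁿ, 𝕜)` with entries `∏ i, (c i)^(k i)`, where
`‖c i‖ < 1` for all `i`, exists as a continuous linear map and is compact.  This is the
key analytic step showing that the inclusion `T_𝕜ⁿ(ρ) → T_𝕜ⁿ(1)` for `ρ > 1` is a
compact map. -/
theorem diagonal_operator_lp_one_isCompactOperator
    (𝕜 : Type*) [NormedField 𝕜] [ProperSpace 𝕜] (n : ℕ)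
    (c : Fin n → 𝕜) (hc : ∀ i, ‖c i‖ < 1) :
    ∃ T : lp (fun _ : Fin n → ℕ => 𝕜) 1 →L[𝕜] lp (fun _ : Fin n → ℕ => 𝕜) 1,
      (∀ (a : lp (fun _ : Fin n → ℕ => 𝕜) 1) (k : Fin n → ℕ),
        (T a : ∀ _ : Fin n → ℕ, 𝕜) k = (∏ i, (c i) ^ (k i)) * (a : ∀ _ : Fin n → ℕ, 𝕜) k) ∧
      IsCompactOperator T := by
  classical
  set d : (Fin n → ℕ) → 𝕜 := fun k => ∏ i, (c i) ^ (k i) with hd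
  have hsum : Summable fun k => ‖d k‖ := by
    simpa [hd, norm_prod, norm_pow] using
      summable_prod_pow_aux n (fun i => ‖c i‖) (fun i => norm_nonneg _) hc
  have hd1 : ∀ k, ‖d k‖ ≤ 1 := fun k => by
    simp only [hd, norm_prod, norm_pow]
    exact Finset.prod_le_one (fun i _ => by positivity)
      (fun i _ => pow_le_one₀ (norm_nonneg _) (hc i).le)
  have hle : ∀ (a : lp (fun _ : Fin n → ℕ => 𝕜) 1) k, ‖d k * a k‖ ≤ ‖a k‖ := fun a k => by
    rw [norm_mul]
    exact mul_le_of_le_one_left (norm_nonneg _) (hd1 k)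
  have hmem : ∀ a : lp (fun _ : Fin n → ℕ => 𝕜) 1,
      Memℓp (fun k => d k * a k) 1 := fun a => (lp.memℓp a).mono' (hle a)
  let L : lp (fun _ : Fin n → ℕ => 𝕜) 1 →ₗ[𝕜] lp (fun _ : Fin n → ℕ => 𝕜) 1 :=
    { toFun := fun a => ⟨fun k => d k * a k, hmem a⟩
      map_add' := fun a b => by
        ext k
        exact mul_add _ _ _
      map_smul' := fun r a => by
        ext k
        exact mul_left_comm _ _ _ }
  have hL : ∀ a k, L a k = d k * a k := fun a k => rfl
  refine ⟨L.mkContinuous 1 fun a => ?_, fun a k => rfl, ?_⟩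
  · rw [one_mul]
    exact lp.norm_mono one_ne_zero (fun k => hle a k)
  · let φ : ((Fin n → ℕ) → 𝕜) → lp (fun _ : Fin n → ℕ => 𝕜) 1 :=
      fun x => ∑' k, lp.single 1 k (x k)
    let S : Set ((Fin n → ℕ) → 𝕜) := Set.pi Set.univ fun k => Metric.closedBall 0 ‖d k‖
    have hS : IsCompact S := isCompact_univ_pi fun k => isCompact_closedBall _ _
    have hφ : ContinuousOn φ S := by
      refine continuousOn_tsum (fun k => ?_) hsum fun k x hx => ?_
      · exact ((lp.isometry_single (E := fun _ : Fin n → ℕ => 𝕜) (p := 1) k).continuous.comp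
          (continuous_apply k)).continuousOn
      · rw [lp.norm_single (by simp)]
        simpa using hx k (Set.mem_univ k)
    refine ⟨φ '' S, hS.image_of_continuousOn hφ, ?_⟩
    refine Filter.mem_of_superset (Metric.closedBall_mem_nhds 0 one_pos) fun a ha => ?_
    refine ⟨fun k => d k * a k, fun k _ => ?_, ?_⟩
    · have h1 : ‖a k‖ ≤ 1 := (lp.norm_apply_le_norm one_ne_zero a k).trans (by simpa using ha)
      rw [mem_closedBall_zero_iff, norm_mul]
      exact mul_le_of_le_one_right (norm_nonneg _) h1
    · exact (lp.hasSum_single ENNReal.one_ne_top (L a)).tsum_eq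
end

section
/- Let A be a commutative complex Banach algebra (a complete normed commutative ring with a ℂ-normed-algebra structure) and let f : Fin n → A. Write X(A) for the character space of A (Mathlib's WeakDual.characterSpace ℂ A, the nonzero continuous ℂ-algebra homomorphisms φ : A → ℂ). Then the following are equivalent: (i) for every g : Fin n → A such that ‖ψ(g i)‖ ≤ 1 for every i and every ψ ∈ X(A), one has ‖φ(∑_i (f i)·(g i))‖ ≤ 1 for every φ ∈ X(A); (ii) ∑_i ‖φ(f i)‖ ≤ 1 for every φ ∈ X(A). -/
/-- For a commutative complex Banach algebra `A` and a tuple `f : Fin n → A`, the tuple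
satisfies the "absolute convexity" condition `(f_1, …, f_n) ∈ Σ_{A^⋄}(n)` — i.e. every
character-bounded combination `∑ f_i g_i` remains character-bounded — if and only if
`∑ i, ‖φ (f i)‖ ≤ 1` for every character `φ` of `A`. -/
theorem sigma_characterization_banach_algebra
    (A : Type*) [NormedCommRing A] [NormedAlgebra ℂ A] [CompleteSpace A]
    (n : ℕ) (f : Fin n → A) :
    (∀ g : Fin n → A,
      (∀ i, ∀ ψ : WeakDual.characterSpace ℂ A, ‖ψ (g i)‖ ≤ 1) →
      ∀ φ : WeakDual.characterSpace ℂ A, ‖φ (∑ i, f i * g i)‖ ≤ 1) ↔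
    ∀ φ : WeakDual.characterSpace ℂ A, ∑ i, ‖φ (f i)‖ ≤ 1 := by
  constructor
  · intro h φ
    have hz : ∀ z : ℂ, z * ((starRingEnd ℂ) z / (‖z‖ : ℂ)) = (‖z‖ : ℂ) := by
      intro z
      rw [← mul_div_assoc, Complex.mul_conj']
      by_cases hz : (‖z‖ : ℂ) = 0
      · simp [hz]
      · field_simp
    have key := h (fun i => algebraMap ℂ A ((starRingEnd ℂ) (φ (f i)) / (‖φ (f i)‖ : ℂ))) ?_ φ
    · have e : φ (∑ i, f i * algebraMap ℂ A ((starRingEnd ℂ) (φ (f i)) / (‖φ (f i)‖ : ℂ)))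
          = ((∑ i, ‖φ (f i)‖ : ℝ) : ℂ) := by
        rw [map_sum, Complex.ofReal_sum]
        refine Finset.sum_congr rfl fun i _ => ?_
        rw [map_mul, AlgHomClass.commutes φ, Algebra.algebraMap_self, RingHom.id_apply, hz]
      rw [e, Complex.norm_real] at key
      exact (le_abs_self _).trans key
    · intro i ψ
      rw [AlgHomClass.commutes ψ, Algebra.algebraMap_self, RingHom.id_apply, norm_div,
        RCLike.norm_conj, Complex.norm_real, norm_norm]
      exact div_self_le_one _
  · intro h g hg φ
    rw [map_sum]
    refine (norm_sum_le _ _).trans ((Finset.sum_le_sum fun i _ => ?_).trans (h φ))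
    rw [map_mul, norm_mul]
    exact mul_le_of_le_one_right (norm_nonneg _) (hg i φ)
end

section
/- Let A be a commutative ring with 1 equipped with a bornology (in Mathlib's sense: the bounded sets are downward closed, closed under finite unions, and contain all finite sets) such that the pointwise product s * t of any two bounded subsets s, t ⊆ A is bounded, let V be an A-module, and let S ⊆ V. Let H be the set of all elements of the form λ_1 • x_1 + ⋯ + λ_n • x_n with n ≥ 1, (λ_1,…,λ_n) ∈ ℛⁿ(A°) and x_1,…,x_n ∈ S. Then H is absolutely convex, S ⊆ H, and H is contained in every absolutely convex subset of V containing S; hence H equals the absolutely convex hull Γ(S) of S, defined as the intersection of all absolutely convex subsets of V containing S. -/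
open Pointwise

/-- `x` is power-bounded: the set of its powers is bounded. -/
def IsPowerBounded {A : Type*} [Monoid A] [Bornology A] (x : A) : Prop :=
  Bornology.IsBounded (Set.range fun m : ℕ => x ^ m)

/-- `λ ∈ ℛⁿ(A°)`: the combination `∑ λ_i x_i` is power-bounded whenever all the
`x_i` are power-bounded. -/
def MemR {A : Type*} [CommRing A] [Bornology A] {n : ℕ} (lam : Fin n → A) : Prop :=
  ∀ x : Fin n → A, (∀ i, IsPowerBounded (x i)) → IsPowerBounded (∑ i, lam i * x i)

/-- A subset `T` of an `A`-module `V` is absolutely convex if it is stable under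
combinations `∑ λ_i • x_i` with `(λ_1, …, λ_n) ∈ ℛⁿ(A°)` and `x_i ∈ T`. -/
def AbsolutelyConvex {A : Type*} [CommRing A] [Bornology A]
    {V : Type*} [AddCommGroup V] [Module A V] (T : Set V) : Prop :=
  ∀ (n : ℕ), 1 ≤ n → ∀ lam : Fin n → A, MemR lam →
    ∀ x : Fin n → V, (∀ i, x i ∈ T) → (∑ i, lam i • x i) ∈ T

/-- The set of all combinations `∑ λ_i • x_i` with `(λ_1, …, λ_n) ∈ ℛⁿ(A°)` and
`x_i ∈ S` is absolutely convex, contains `S`, is contained in every absolutely convex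
set containing `S`, and hence equals the absolutely convex hull `Γ(S)` of `S`
(the intersection of all absolutely convex subsets of `V` containing `S`). -/
theorem absolutelyConvexHull_eq_combinations
    (A : Type*) [CommRing A] [Bornology A]
    (hmul : ∀ s t : Set A, Bornology.IsBounded s → Bornology.IsBounded t →
      Bornology.IsBounded (s * t))
    (V : Type*) [AddCommGroup V] [Module A V] (S : Set V) :
    AbsolutelyConvex (A := A)
      {v : V | ∃ (n : ℕ) (_ : 1 ≤ n) (lam : Fin n → A) (x : Fin n → V),
        MemR lam ∧ (∀ i, x i ∈ S) ∧ v = ∑ i, lam i • x i} ∧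
    S ⊆ {v : V | ∃ (n : ℕ) (_ : 1 ≤ n) (lam : Fin n → A) (x : Fin n → V),
        MemR lam ∧ (∀ i, x i ∈ S) ∧ v = ∑ i, lam i • x i} ∧
    (∀ T : Set V, AbsolutelyConvex (A := A) T → S ⊆ T →
      {v : V | ∃ (n : ℕ) (_ : 1 ≤ n) (lam : Fin n → A) (x : Fin n → V),
        MemR lam ∧ (∀ i, x i ∈ S) ∧ v = ∑ i, lam i • x i} ⊆ T) ∧
    {v : V | ∃ (n : ℕ) (_ : 1 ≤ n) (lam : Fin n → A) (x : Fin n → V),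
        MemR lam ∧ (∀ i, x i ∈ S) ∧ v = ∑ i, lam i • x i} =
      ⋂₀ {T : Set V | AbsolutelyConvex (A := A) T ∧ S ⊆ T} := by
  have h1 : AbsolutelyConvex (A := A)
      {v : V | ∃ (n : ℕ) (_ : 1 ≤ n) (lam : Fin n → A) (x : Fin n → V),
        MemR lam ∧ (∀ i, x i ∈ S) ∧ v = ∑ i, lam i • x i} := by
    intro n hn lam hlam x hx
    choose m hm mu y hmu hy hxy using hx
    let e := finSigmaFinEquiv (n := m)
    obtain ⟨M, hM⟩ : ∃ M : (Σ i, Fin (m i)) → A, ∀ i j, M ⟨i, j⟩ = mu i j :=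
      ⟨fun p => mu p.1 p.2, fun _ _ => rfl⟩
    obtain ⟨Y, hY⟩ : ∃ Y : (Σ i, Fin (m i)) → V, ∀ i j, Y ⟨i, j⟩ = y i j :=
      ⟨fun p => y p.1 p.2, fun _ _ => rfl⟩
    have hYS : ∀ p, Y p ∈ S := fun ⟨i, j⟩ => by rw [hY]; exact hy i j
    refine ⟨∑ i, m i, ?_, fun k => lam (e.symm k).1 * M (e.symm k),
      fun k => Y (e.symm k), ?_, fun k => hYS _, ?_⟩
    · exact (hm ⟨0, hn⟩).trans
        (Finset.single_le_sum (f := m) (fun _ _ => Nat.zero_le _) (Finset.mem_univ _))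
    · intro z hz
      have key := hlam (fun i => ∑ j, mu i j * z (e ⟨i, j⟩))
        (fun i => hmu i _ (fun j => hz _))
      convert key using 1
      rw [← Equiv.sum_comp e, Fintype.sum_sigma]
      simp [hM, Finset.mul_sum, mul_assoc]
    · rw [← Equiv.sum_comp e, Fintype.sum_sigma]
      simp [hxy, hM, hY, Finset.smul_sum, mul_smul]
  have h2 : S ⊆ {v : V | ∃ (n : ℕ) (_ : 1 ≤ n) (lam : Fin n → A) (x : Fin n → V),
        MemR lam ∧ (∀ i, x i ∈ S) ∧ v = ∑ i, lam i • x i} := by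
    intro s hs
    refine ⟨1, le_rfl, fun _ => 1, fun _ => s, ?_, fun _ => hs, by simp⟩
    intro x hx
    simpa using hx 0
  have h3 : ∀ T : Set V, AbsolutelyConvex (A := A) T → S ⊆ T →
      {v : V | ∃ (n : ℕ) (_ : 1 ≤ n) (lam : Fin n → A) (x : Fin n → V),
        MemR lam ∧ (∀ i, x i ∈ S) ∧ v = ∑ i, lam i • x i} ⊆ T := by
    rintro T hT hST _ ⟨n, hn, lam, x, hlam, hx, rfl⟩
    exact hT n hn lam hlam x (fun i => hST (hx i))
  refine ⟨h1, h2, h3, Set.Subset.antisymm ?_ ?_⟩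
  · rintro v hv T ⟨hT, hST⟩
    exact h3 T hT hST hv
  · exact Set.sInter_subset_of_mem ⟨h1, h2⟩
end

section
/- Let A be a commutative ring with 1 equipped with a bornology (in Mathlib's sense: the bounded sets are downward closed, closed under finite unions, and contain all finite sets) such that the pointwise sum s + t and the pointwise product s * t of any two bounded subsets s, t ⊆ A are bounded. Assume the set A° of power-bounded elements is bounded. If B ⊆ A is contained in a finite union x_1·A° ∪ ⋯ ∪ x_m·A° of dilates of A° (with x_1,…,x_m ∈ A), then the set of all combinations λ_1 b_1 + ⋯ + λ_n b_n with n ≥ 1, (λ_1,…,λ_n) ∈ ℛⁿ(A°) and b_1,…,b_n ∈ B (i.e. the absolutely convex hull Γ(B) of B) is a bounded subset of A. In particular, in a bornological ring of bounded convex type the absolutely convex hull of every bounded set is bounded. -/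
open Pointwise

/-- In a bornological ring in which `A°` is bounded, if `B` is contained in a finite
union of dilates `x_1·A° ∪ ⋯ ∪ x_m·A°`, then the absolutely convex hull `Γ(B)` of `B`,
i.e. the set of all combinations `∑ λ_i b_i` with `(λ_1, …, λ_n) ∈ ℛⁿ(A°)` and
`b_i ∈ B`, is bounded.  In particular, in a bornological ring of bounded convex type
the absolutely convex hull of every bounded set is bounded. -/
theorem isBounded_absolutelyConvexHull_of_boundedConvexType
    (A : Type*) [CommRing A] [Bornology A]
    (hadd : ∀ s t : Set A, Bornology.IsBounded s → Bornology.IsBounded t →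
      Bornology.IsBounded (s + t))
    (hmul : ∀ s t : Set A, Bornology.IsBounded s → Bornology.IsBounded t →
      Bornology.IsBounded (s * t))
    (hpb : Bornology.IsBounded {a : A | IsPowerBounded a})
    (B : Set A) (m : ℕ) (x : Fin m → A)
    (hB : B ⊆ ⋃ i, x i • {a : A | IsPowerBounded a}) :
    Bornology.IsBounded
      {v : A | ∃ (n : ℕ) (_ : 1 ≤ n) (lam b : Fin n → A),
        MemR lam ∧ (∀ i, b i ∈ B) ∧ v = ∑ i, lam i * b i} := by
  classical
  have h0 : IsPowerBounded (0 : A) := by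
    refine ((Set.toFinite ({0, 1} : Set A)).isBounded).subset ?_
    rintro _ ⟨k, rfl⟩
    rcases k with _ | k <;> simp
  have hsum : ∀ s : Finset (Fin m),
      Bornology.IsBounded (∑ j ∈ s, ({x j} : Set A) * {a : A | IsPowerBounded a}) := by
    intro s
    induction s using Finset.induction_on with
    | empty =>
      rw [Finset.sum_empty]
      exact (Set.finite_singleton (0 : A)).isBounded
    | insert j s hj ih =>
      rw [Finset.sum_insert hj]
      exact hadd _ _ (hmul _ _ (Set.finite_singleton (x j)).isBounded hpb) ih
  refine (hsum Finset.univ).subset ?_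
  rintro v ⟨n, -, lam, b, hlam, hb, rfl⟩
  have hb' : ∀ i, ∃ j, ∃ a, IsPowerBounded a ∧ x j * a = b i := by
    intro i
    obtain ⟨j, a, ha, h⟩ := Set.mem_iUnion.1 (hB (hb i))
    exact ⟨j, a, ha, h⟩
  choose j a ha hja using hb'
  have key : ∑ i, lam i * b i
      = ∑ k, x k * ∑ i, lam i * (if j i = k then a i else 0) := by
    simp_rw [Finset.mul_sum]
    rw [Finset.sum_comm]
    refine Finset.sum_congr rfl fun i _ => ?_
    rw [Finset.sum_eq_single (j i)]
    · rw [if_pos rfl, ← hja i]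
      ring
    · intro k _ hk
      rw [if_neg (Ne.symm hk)]
      simp
    · simp
  rw [key]
  refine Set.finset_sum_mem_finset_sum _ _ _ fun k _ => ?_
  refine Set.mul_mem_mul (Set.mem_singleton _) (hlam _ fun i => ?_)
  split_ifs
  · exact ha i
  · exact h0
end

section
/- Let S = {1/p : p a prime number} ⊆ ℚ. Then: (1) S is an infinite set; (2) |x| ≤ 1 for every x ∈ S, where |·| is the archimedean absolute value; (3) for every prime q and every x ∈ S, the q-adic norm satisfies padicNorm q x ≤ q. Consequently S is bounded for the archimedean bornology ℬ_∞ on ℚ and for every p-adic bornology ℬ_p, while being infinite, so the intersection bornology ℬ_∞ ∩ ⋂_p ℬ_p is strictly larger than the trivial bornology of finite subsets. -/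
/-- The set `S = {1/p : p prime} ⊆ ℚ` is infinite, bounded by `1` for the archimedean
absolute value, and for each prime `q` bounded by `q` for the `q`-adic norm.  Hence it
is a bounded set for the archimedean bornology and for every `p`-adic bornology on `ℚ`
while being infinite, so the intersection of these bornologies is strictly larger than
the trivial bornology of finite sets. -/
theorem inverse_primes_bounded_all_norms :
    Set.Infinite {x : ℚ | ∃ p : ℕ, p.Prime ∧ x = 1 / (p : ℚ)} ∧
    (∀ x ∈ {x : ℚ | ∃ p : ℕ, p.Prime ∧ x = 1 / (p : ℚ)}, |x| ≤ 1) ∧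
    ∀ q : ℕ, q.Prime →
      ∀ x ∈ {x : ℚ | ∃ p : ℕ, p.Prime ∧ x = 1 / (p : ℚ)}, padicNorm q x ≤ (q : ℚ) := by
  refine ⟨?_, ?_, ?_⟩
  · have h := Nat.infinite_setOf_prime.image (f := fun p : ℕ => 1 / (p : ℚ)) (by
      intro a _ b _ hab
      simpa using hab)
    refine h.mono ?_
    rintro x ⟨p, hp, rfl⟩
    exact ⟨p, hp, rfl⟩
  · rintro x ⟨p, hp, rfl⟩
    have h1 : (1 : ℚ) ≤ p := by exact_mod_cast hp.one_lt.le
    rw [abs_of_nonneg (by positivity)]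
    exact (div_le_one (by linarith)).2 h1
  · rintro q hq x ⟨p, hp, rfl⟩
    haveI := Fact.mk hq
    haveI := Fact.mk hp
    have h1 : (1 : ℚ) ≤ q := by exact_mod_cast hq.one_lt.le
    rw [padicNorm.div, padicNorm.one]
    by_cases h : q = p
    · subst h
      rw [padicNorm.padicNorm_p_of_prime]
      simp
    · rw [padicNorm.padicNorm_of_prime_of_ne h]
      simpa using h1
end
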